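/- A word u ∈ L(Ω) with |u| > 1 is bispecial if and only if there exists a bispecial word v ∈ L(Ω) such that u = σ(v)·p, where p is the one-letter word 1 if the last letter of v is d−1, and p is the empty word otherwise. -/

import Mathlib

/-- The substitution σ on the alphabet A = {1, …, d}:
σ(1) = 12, σ(k) = k+1 for 2 ≤ k ≤ d−1, σ(d) = 1. Letters are literal natural numbers. -/
def sig (d : ℕ) (a : ℕ) : List ℕ :=
  if a = 1 then [1, 2] else if a = d then [1] else [a + 1]

/-- Extension of a substitution to finite words by concatenation. -/
def applySub (f : ℕ → List ℕ) : List ℕ → List ℕ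
  | [] => []
  | a :: w => f a ++ applySub f w

/-- σⁿ applied to a word. -/
def sigIter (d n : ℕ) (w : List ℕ) : List ℕ := (applySub (sig d))^[n] w

/-- The language L(Ω): the set of finite factors of the fixed point ω, i.e. of the
words σⁿ(1). -/
def Lang (d : ℕ) (u : List ℕ) : Prop := ∃ n : ℕ, u <:+: sigIter d n [1]

/-- `w` is a (finite) prefix of the infinite word `V`. -/
def PrefixOfInf (w : List ℕ) (V : ℕ → ℕ) : Prop :=
  ∀ (i : ℕ) (h : i < w.length), w.get ⟨i, h⟩ = V i

/-- `ω` is the fixed point of σ: the unique infinite word admitting every σⁿ(1) as a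
prefix. -/
def IsSigmaFixedPoint (d : ℕ) (ω : ℕ → ℕ) : Prop :=
  ∀ n : ℕ, PrefixOfInf (sigIter d n [1]) ω

/-- `u` is left-special: there are distinct letters a, b ∈ A with au, bu ∈ L(Ω). -/
def LeftSpecial (d : ℕ) (u : List ℕ) : Prop :=
  ∃ a b : ℕ, a ≠ b ∧ 1 ≤ a ∧ a ≤ d ∧ 1 ≤ b ∧ b ≤ d ∧
    Lang d (a :: u) ∧ Lang d (b :: u)

/-- `u` is right-special: there are distinct letters a, b ∈ A with ua, ub ∈ L(Ω). -/
def RightSpecial (d : ℕ) (u : List ℕ) : Prop :=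
  ∃ a b : ℕ, a ≠ b ∧ 1 ≤ a ∧ a ≤ d ∧ 1 ≤ b ∧ b ≤ d ∧
    Lang d (u ++ [a]) ∧ Lang d (u ++ [b])

/-- `u` is bispecial: both left- and right-special. -/
def Bispecial (d : ℕ) (u : List ℕ) : Prop := LeftSpecial d u ∧ RightSpecial d u

/-- The shift S on infinite words. -/
def shiftMap (V : ℕ → ℕ) : ℕ → ℕ := fun i => V (i + 1)

/-- Ω⁺ : the closure (for the product topology, letters discrete) of the shift
orbit of ω. -/
def OmegaPlus (ω : ℕ → ℕ) : Set (ℕ → ℕ) :=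
  closure {V : ℕ → ℕ | ∃ n : ℕ, V = shiftMap^[n] ω}

/-- The cylinder C_u = {V ∈ Ω⁺ : u is a prefix of V}. -/
def Cyl (ω : ℕ → ℕ) (u : List ℕ) : Set (ℕ → ℕ) :=
  {V | V ∈ OmegaPlus ω ∧ PrefixOfInf u V}

/-- Prepending a letter to an infinite word. -/
def consInf (a : ℕ) (V : ℕ → ℕ) : ℕ → ℕ :=
  fun i => match i with
  | 0 => a
  | j + 1 => V j

/-- Extension of σ to infinite words: σ(V) = σ(V₀)σ(V₁)σ(V₂)⋯ (each σ(a) is a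
nonempty word, so the n-th letter of σ(V) is the n-th letter of σ(V₀…Vₙ)). -/
def sigInf (d : ℕ) (V : ℕ → ℕ) : ℕ → ℕ :=
  fun n => (applySub (sig d) ((List.range (n + 1)).map V)).getD n 0

/-- Concatenation of a finite list of words. -/
def concatAll : List (List ℕ) → List ℕ
  | [] => []
  | w :: ws => w ++ concatAll ws

/-- All letters of the word lie in the alphabet {1, …, d}. -/
def IsOver (d : ℕ) (w : List ℕ) : Prop := ∀ a ∈ w, 1 ≤ a ∧ a ≤ d

/-- Each letter `a` of the word is followed by `1` or by `a + 1`. -/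
def IsStepChain (w : List ℕ) : Prop := w.IsChain fun a b => b = 1 ∨ b = a + 1

lemma sig_one (d : ℕ) : sig d 1 = [1, 2] := by simp [sig]

lemma sig_top {d : ℕ} (hd : 3 ≤ d) : sig d d = [1] := by
  have : d ≠ 1 := by omega
  simp [sig, this]

lemma sig_mid {d a : ℕ} (h1 : a ≠ 1) (h2 : a ≠ d) : sig d a = [a + 1] := by
  simp [sig, h1, h2]

lemma sig_ne_nil (d a : ℕ) : sig d a ≠ [] := by
  unfold sig; split_ifs <;> simp

lemma applySub_append (f : ℕ → List ℕ) (x y : List ℕ) :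
    applySub f (x ++ y) = applySub f x ++ applySub f y := by
  induction x with
  | nil => rfl
  | cons a x ih => simp [applySub, ih]

lemma applySub_singleton (f : ℕ → List ℕ) (a : ℕ) : applySub f [a] = f a := by
  simp [applySub]

lemma applySub_sig_eq_nil {d : ℕ} {x : List ℕ} (h : applySub (sig d) x = []) : x = [] := by
  cases x with
  | nil => rfl
  | cons a x => simp [applySub, sig_ne_nil] at h

lemma List.IsInfix.applySub {x y : List ℕ} (h : x <:+: y) (f : ℕ → List ℕ) :
    applySub f x <:+: applySub f y := by
  obtain ⟨s, t, rfl⟩ := h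
  exact ⟨_root_.applySub f s, _root_.applySub f t, by simp [applySub_append]⟩

lemma sigIter_succ (d n : ℕ) (w : List ℕ) :
    sigIter d (n + 1) w = applySub (sig d) (sigIter d n w) :=
  Function.iterate_succ_apply' _ _ _

lemma sigIter_append (d n : ℕ) (x y : List ℕ) :
    sigIter d n (x ++ y) = sigIter d n x ++ sigIter d n y := by
  induction n with
  | zero => rfl
  | succ n ih => simp [sigIter_succ, ih, applySub_append]

lemma sigIter_ne_nil (d n : ℕ) {w : List ℕ} (hw : w ≠ []) : sigIter d n w ≠ [] := by
  induction n with
  | zero => exact hw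
  | succ n ih =>
    rw [sigIter_succ]
    exact fun h => ih (applySub_sig_eq_nil h)

namespace Lang

variable {d : ℕ} {u w : List ℕ}

lemma of_infix (hw : Lang d w) (h : u <:+: w) : Lang d u := by
  obtain ⟨n, hn⟩ := hw
  exact ⟨n, h.trans hn⟩

lemma applySub (hw : Lang d w) : Lang d (applySub (sig d) w) := by
  obtain ⟨n, hn⟩ := hw
  exact ⟨n + 1, by rw [sigIter_succ]; exact hn.applySub _⟩

lemma exists_desubst (hw : Lang d w) :
    ∃ x, Lang d x ∧ w <:+: _root_.applySub (sig d) x := by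
  obtain ⟨n, hn⟩ := hw
  cases n with
  | zero =>
    refine ⟨[1], ⟨0, List.infix_refl _⟩, hn.trans ?_⟩
    rw [applySub_singleton, sig_one]
    exact ⟨[], [2], rfl⟩
  | succ n => exact ⟨_, ⟨n, List.infix_refl _⟩, by rwa [sigIter_succ] at hn⟩

/-- Every word of the language extends to the right. -/
lemma exists_append (hw : Lang d w) : ∃ c, Lang d (w ++ [c]) := by
  obtain ⟨n, s, t, h⟩ := hw
  have h1 : sigIter d (n + 1) [1] = sigIter d n [1] ++ sigIter d n [2] := by
    rw [← sigIter_append, sigIter, Function.iterate_succ_apply, applySub_singleton, sig_one]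
    rfl
  obtain ⟨c, r, hr⟩ : ∃ c r, t ++ sigIter d n [2] = c :: r :=
    List.exists_cons_of_ne_nil (by simp [sigIter_ne_nil])
  refine ⟨c, n + 1, s, r, ?_⟩
  rw [h1, ← h]
  simp [hr]

end Lang

lemma isOver_sig {d a : ℕ} (hd : 3 ≤ d) (ha : 1 ≤ a ∧ a ≤ d) : IsOver d (sig d a) := by
  intro b hb
  unfold sig at hb
  split_ifs at hb <;> simp at hb <;> omega

lemma IsOver.applySub {d : ℕ} (hd : 3 ≤ d) {w : List ℕ} (h : IsOver d w) :
    IsOver d (applySub (sig d) w) := by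
  induction w with
  | nil => simpa [_root_.applySub] using h
  | cons a w ih =>
    intro b hb
    simp only [_root_.applySub, List.mem_append] at hb
    rcases hb with hb | hb
    · exact isOver_sig hd (h a (by simp)) b hb
    · exact ih (fun c hc => h c (by simp [hc])) b hb

lemma head?_applySub_cons {d a : ℕ} {w : List ℕ} :
    (applySub (sig d) (a :: w)).head? = some (if a = 1 ∨ a = d then 1 else a + 1) := by
  by_cases h1 : a = 1
  · simp [applySub, sig, h1]
  · by_cases h2 : a = d
    · subst h2
      simp [applySub, sig, h1]
    · simp [applySub, sig, h1, h2]

lemma getLast?_sig {d a : ℕ} :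
    (sig d a).getLast? = some (if a = d ∧ a ≠ 1 then 1 else a + 1) := by
  by_cases h1 : a = 1
  · simp [sig, h1]
  · by_cases h2 : a = d <;> simp_all [sig]

lemma IsStepChain.applySub {d : ℕ} (hd : 3 ≤ d) {w : List ℕ} (hw : IsOver d w)
    (h : IsStepChain w) : IsStepChain (applySub (sig d) w) := by
  induction w with
  | nil => exact List.IsChain.nil
  | cons a w ih =>
    have hw' : IsOver d w := fun c hc => hw c (by simp [hc])
    rw [_root_.applySub]
    refine List.isChain_append.2 ⟨?_, ih hw' h.tail, ?_⟩
    · unfold sig; split_ifs <;> simp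
    · intro p hp q hq
      cases w with
      | nil => simp [_root_.applySub] at hq
      | cons b w =>
        have hab := (List.isChain_cons_cons.1 h).1
        have ha := hw a (by simp)
        have hb := hw b (by simp)
        rw [head?_applySub_cons] at hq
        rw [getLast?_sig] at hp
        simp only [Option.mem_def, Option.some.injEq] at hp hq
        split_ifs at hp hq <;> omega

lemma isOver_and_isStepChain_sigIter {d : ℕ} (hd : 3 ≤ d) (n : ℕ) :
    IsOver d (sigIter d n [1]) ∧ IsStepChain (sigIter d n [1]) := by
  induction n with
  | zero =>
    refine ⟨?_, List.IsChain.singleton _⟩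
    intro a ha
    simp [sigIter] at ha
    omega
  | succ n ih =>
    rw [sigIter_succ]
    exact ⟨ih.1.applySub hd, ih.2.applySub hd ih.1⟩

namespace Lang

variable {d : ℕ} {w : List ℕ}

lemma isOver (hd : 3 ≤ d) (hw : Lang d w) : IsOver d w := by
  obtain ⟨n, hn⟩ := hw
  exact fun a ha => (isOver_and_isStepChain_sigIter hd n).1 a (hn.subset ha)

/-- In the language, a letter `a` is followed by `1` or by `a + 1`. -/
lemma step (hd : 3 ≤ d) {s t : List ℕ} {a b : ℕ} (hw : Lang d (s ++ a :: b :: t)) :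
    b = 1 ∨ b = a + 1 := by
  obtain ⟨n, hn⟩ := hw
  have h : IsStepChain [a, b] :=
    (isOver_and_isStepChain_sigIter hd n).2.infix (List.IsInfix.trans ⟨s, t, by simp⟩ hn)
  simpa [IsStepChain] using h

end Lang

lemma head?_applySub_ne_two {d : ℕ} {w : List ℕ} (hw : IsOver d w) :
    (applySub (sig d) w).head? ≠ some 2 := by
  cases w with
  | nil => simp [applySub]
  | cons a w =>
    have := hw a (by simp)
    rw [head?_applySub_cons]
    simp only [ne_eq, Option.some.injEq]
    split_ifs <;> omega

/-- The substitution is injective on words over the alphabet. -/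
lemma applySub_sig_injective {d : ℕ} {x y : List ℕ} (hx : IsOver d x) (hy : IsOver d y)
    (h : applySub (sig d) x = applySub (sig d) y) : x = y := by
  induction x generalizing y with
  | nil => exact (applySub_sig_eq_nil h.symm).symm
  | cons a x ih =>
    cases y with
    | nil => exact applySub_sig_eq_nil h
    | cons b y =>
      have hx' : IsOver d x := fun c hc => hx c (by simp [hc])
      have hy' : IsOver d y := fun c hc => hy c (by simp [hc])
      have ha := hx a (by simp)
      have hb := hy b (by simp)
      by_cases hab : a = b
      · subst hab
        rw [applySub, applySub, List.append_cancel_left_eq] at h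
        rw [ih hx' hy' h]
      · exfalso
        have hhead := congrArg List.head? h
        rw [head?_applySub_cons, head?_applySub_cons, Option.some.injEq] at hhead
        have hx2 := head?_applySub_ne_two hx'
        have hy2 := head?_applySub_ne_two hy'
        have hcase : (a = 1 ∧ b = d) ∨ (a = d ∧ b = 1) := by
          split_ifs at hhead <;> omega
        rcases hcase with ⟨rfl, rfl⟩ | ⟨rfl, rfl⟩
        · rw [applySub, applySub, sig_one, sig, if_neg (Ne.symm hab), if_pos rfl] at h
          simp at h
          simp [← h] at hy2
        · rw [applySub, applySub, sig_one, sig, if_neg hab, if_pos rfl] at h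
          simp at h
          simp [h] at hx2

/-- A factorization of an image `σ(x)` whose second factor does not begin with `2` comes from a
factorization of `x`. -/
lemma exists_split_of_applySub_eq {d : ℕ} {x s t : List ℕ} (ht : t.head? ≠ some 2)
    (h : applySub (sig d) x = s ++ t) :
    ∃ x₁ x₂, x = x₁ ++ x₂ ∧ applySub (sig d) x₁ = s ∧ applySub (sig d) x₂ = t := by
  induction x generalizing s with
  | nil =>
    have h' : s ++ t = [] := h.symm
    obtain ⟨rfl, rfl⟩ := List.append_eq_nil_iff.1 h'
    exact ⟨[], [], rfl, rfl, rfl⟩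
  | cons a x ih =>
    cases s with
    | nil => exact ⟨[], a :: x, rfl, rfl, h⟩
    | cons c s =>
      by_cases h1 : a = 1
      · subst h1
        rw [applySub, sig_one] at h
        cases s with
        | nil =>
          simp at h
          simp [← h.2] at ht
        | cons e s =>
          simp only [List.cons_append, List.nil_append, List.cons.injEq] at h
          obtain ⟨rfl, rfl, h⟩ := h
          obtain ⟨x₁, x₂, rfl, h1, h2⟩ := ih h
          exact ⟨1 :: x₁, x₂, rfl, by rw [applySub, sig_one, h1]; rfl, h2⟩
      · obtain ⟨e, he⟩ : ∃ e, sig d a = [e] := by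
          unfold sig; split_ifs <;> simp
        rw [applySub, he] at h
        simp only [List.cons_append, List.nil_append, List.cons.injEq] at h
        obtain ⟨rfl, h⟩ := h
        obtain ⟨x₁, x₂, rfl, h1, h2⟩ := ih h
        exact ⟨a :: x₁, x₂, rfl, by rw [applySub, he, h1]; rfl, h2⟩

namespace Lang

variable {d : ℕ} {w : List ℕ}

/-- Desubstitution of a factor whose two boundaries are cutting points. -/
lemma desubst {l r : List ℕ} (h : Lang d (l ++ (w ++ r))) (hw : w ≠ []) (hr : r ≠ [])
    (hw2 : w.head? ≠ some 2) (hr2 : r.head? ≠ some 2) :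
    ∃ x y z, Lang d (x ++ (y ++ z)) ∧ l <:+ _root_.applySub (sig d) x ∧
      _root_.applySub (sig d) y = w ∧ r <+: _root_.applySub (sig d) z := by
  obtain ⟨X, hX, s, t, hst⟩ := h.exists_desubst
  obtain ⟨c, w, rfl⟩ := List.exists_cons_of_ne_nil hw
  obtain ⟨e, r, rfl⟩ := List.exists_cons_of_ne_nil hr
  obtain ⟨x, X, rfl, h1, h2⟩ := exists_split_of_applySub_eq (d := d) (x := X) (s := s ++ l)
    (t := (c :: w) ++ ((e :: r) ++ t)) (by simpa using hw2) (by simp [← hst])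
  obtain ⟨y, z, rfl, h3, h4⟩ := exists_split_of_applySub_eq (by simpa using hr2) h2
  exact ⟨x, y, z, hX, ⟨s, h1.symm⟩, h3, ⟨t, h4.symm⟩⟩

lemma desubst_left (hd : 3 ≤ d) {r v : List ℕ} {a : ℕ} (hv : IsOver d v)
    (hvw : _root_.applySub (sig d) v = w)
    (h : Lang d (a :: (w ++ r))) (hw : w ≠ []) (hr : r ≠ [])
    (hw2 : w.head? ≠ some 2) (hr2 : r.head? ≠ some 2) :
    ∃ b, 1 ≤ b ∧ b ≤ d ∧ Lang d (b :: v) ∧ (sig d b).getLast? = some a := by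
  obtain ⟨x, y, z, hL, ⟨s, hs⟩, hy, -⟩ := desubst (l := [a]) h hw hr hw2 hr2
  have hyv : y = v := applySub_sig_injective
    (fun c hc => hL.isOver hd c (by simp [hc])) hv (hy.trans hvw.symm)
  subst hyv
  rcases List.eq_nil_or_concat x with rfl | ⟨x, b, rfl⟩
  · simp [_root_.applySub] at hs
  · have hb := hL.isOver hd b (by simp)
    refine ⟨b, hb.1, hb.2, hL.of_infix ⟨x, z, by simp⟩, ?_⟩
    have := congrArg List.getLast? hs
    rw [List.concat_eq_append, applySub_append, applySub_singleton,
      List.getLast?_append_of_ne_nil _ (sig_ne_nil d b)] at this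
    simp at this
    exact this.symm

lemma desubst_right {r : List ℕ} (h : Lang d (w ++ r)) (hw : w ≠ []) (hr : r ≠ [])
    (hw2 : w.head? ≠ some 2) (hr2 : r.head? ≠ some 2) :
    ∃ v c z, Lang d (v ++ c :: z) ∧ _root_.applySub (sig d) v = w ∧
      r <+: _root_.applySub (sig d) (c :: z) := by
  obtain ⟨x, y, z, hL, -, hy, hz⟩ := desubst (l := []) h hw hr hw2 hr2
  cases z with
  | nil => simp [_root_.applySub, hr] at hz
  | cons c z => exact ⟨y, c, z, hL.of_infix ⟨x, [], by simp⟩, hy, hz⟩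

end Lang

/-- A nonempty left-special word begins with `1`. -/
lemma LeftSpecial.head_eq_one {d c : ℕ} (hd : 3 ≤ d) {w : List ℕ} (h : LeftSpecial d (c :: w)) :
    c = 1 := by
  obtain ⟨a, b, hab, -, -, -, -, ha, hb⟩ := h
  have h1 := Lang.step hd (s := []) ha
  have h2 := Lang.step hd (s := []) hb
  omega

/-- A right-special word ending in `k` has right extensions `1` and `k + 1`. -/
lemma RightSpecial.extensions {d k : ℕ} (hd : 3 ≤ d) {w : List ℕ}
    (h : RightSpecial d (w ++ [k])) :
    Lang d (w ++ [k] ++ [1]) ∧ Lang d (w ++ [k] ++ [k + 1]) := by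
  obtain ⟨a, b, hab, -, -, -, -, ha, hb⟩ := h
  have h1 := Lang.step hd (s := w) (t := []) (by simpa using ha)
  have h2 := Lang.step hd (s := w) (t := []) (by simpa using hb)
  rcases h1 with rfl | rfl <;> rcases h2 with rfl | rfl
  · exact absurd rfl hab
  · exact ⟨ha, hb⟩
  · exact ⟨hb, ha⟩
  · exact absurd rfl hab

/-- Desubstitution preserves left-speciality. -/
lemma LeftSpecial.desubst {d : ℕ} (hd : 3 ≤ d) {v r : List ℕ} (hv : IsOver d v) (hv0 : v ≠ [])
    (hv2 : (applySub (sig d) v).head? ≠ some 2)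
    (hr2 : ∀ a c, Lang d (a :: (applySub (sig d) v ++ r ++ [c])) → (r ++ [c]).head? ≠ some 2)
    (h : LeftSpecial d (applySub (sig d) v ++ r)) : LeftSpecial d v := by
  have key : ∀ a, Lang d (a :: (applySub (sig d) v ++ r)) →
      ∃ b, 1 ≤ b ∧ b ≤ d ∧ Lang d (b :: v) ∧ (sig d b).getLast? = some a := by
    intro a ha
    obtain ⟨c, hc⟩ := ha.exists_append
    exact Lang.desubst_left hd hv rfl (r := r ++ [c]) (by simpa using hc)
      (fun h => hv0 (applySub_sig_eq_nil h)) (by simp) hv2 (hr2 a c (by simpa using hc))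
  obtain ⟨a, b, hab, -, -, -, -, ha, hb⟩ := h
  obtain ⟨a', h1, h2, h3, h4⟩ := key a ha
  obtain ⟨b', h5, h6, h7, h8⟩ := key b hb
  refine ⟨a', b', ?_, h1, h2, h5, h6, h3, h7⟩
  rintro rfl
  exact hab (Option.some.inj (h4.symm.trans h8))

/-- Last letter of a preimage under the substitution. -/
lemma getLast?_of_applySub_append {d : ℕ} {v w : List ℕ} {k : ℕ}
    (h : applySub (sig d) v = w ++ [k]) :
    ∃ v' e, v = v' ++ [e] ∧ (sig d e).getLast? = some k := by
  rcases List.eq_nil_or_concat v with rfl | ⟨v', e, rfl⟩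
  · simp [applySub] at h
  · refine ⟨v', e, by simp, ?_⟩
    have := congrArg List.getLast? h
    rwa [List.concat_eq_append, applySub_append, applySub_singleton,
      List.getLast?_append_of_ne_nil _ (sig_ne_nil d e), List.getLast?_concat] at this

/-- A bispecial word of length at least two ending in a letter `k ≥ 2` is the image of a
bispecial word. -/
lemma Bispecial.desubst_of_two_le {d k : ℕ} (hd : 3 ≤ d) {w : List ℕ} (hk : 2 ≤ k)
    (hw : (w ++ [k]).head? ≠ some 2) (h : Bispecial d (w ++ [k])) :
    ∃ v, Lang d v ∧ Bispecial d v ∧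
      w ++ [k] = applySub (sig d) v ++ (if v.getLast? = some (d - 1) then [1] else []) := by
  obtain ⟨hl, hr⟩ := h
  obtain ⟨h1, h2⟩ := hr.extensions hd
  have hkd := h2.isOver hd (k + 1) (by simp)
  obtain ⟨v, c, z, hL, hv, hz⟩ := h1.desubst_right (by simp) (by simp) hw (by simp)
  obtain ⟨v', c', z', hL', hv', hz'⟩ := h2.desubst_right (by simp) (by simp) hw
    (by simp; omega)
  have hov : IsOver d v := fun a ha => hL.isOver hd a (by simp [ha])
  have hov' : IsOver d v' := fun a ha => hL'.isOver hd a (by simp [ha])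
  obtain rfl : v = v' := applySub_sig_injective hov hov' (hv.trans hv'.symm)
  have hc := hL.isOver hd c (by simp)
  have hc' := hL'.isOver hd c' (by simp)
  have hcc : c ≠ c' := by
    rintro rfl
    obtain ⟨s, hs⟩ := hz
    obtain ⟨s', hs'⟩ := hz'
    have e1 := congrArg List.head? hs
    have e2 := congrArg List.head? hs'
    rw [head?_applySub_cons] at e1 e2
    have := e1.trans (e2.symm)
    simp at this
    omega
  obtain ⟨v₀, e, rfl, he⟩ := getLast?_of_applySub_append hv
  have hed := hov e (by simp)
  rw [getLast?_sig, Option.some.injEq] at he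
  refine ⟨v₀ ++ [e], hL.of_infix ⟨[], c :: z, by simp⟩, ⟨?_, ?_⟩, ?_⟩
  · refine LeftSpecial.desubst hd (r := []) hov (by simp) (by rwa [hv]) ?_ (by simpa [hv] using hl)
    intro a b hab
    rw [hv] at hab
    have := Lang.step hd (s := a :: w) (a := k) (b := b) (t := []) (by simpa using hab)
    simp
    omega
  · exact ⟨c, c', hcc, hc.1, hc.2, hc'.1, hc'.2, hL.of_infix ⟨[], z, by simp⟩,
      hL'.of_infix ⟨[], z', by simp⟩⟩
  · have : e ≠ d - 1 := by split_ifs at he <;> omega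
    simp [hv, this]

/-- A bispecial word of length at least two ending in `1` is the image of a bispecial word
ending in `d - 1`, followed by `1`. -/
lemma Bispecial.desubst_of_one {d : ℕ} (hd : 3 ≤ d) {w : List ℕ} (hw0 : w ≠ [])
    (hw : w.head? ≠ some 2) (h : Bispecial d (w ++ [1])) :
    ∃ v, Lang d v ∧ Bispecial d v ∧
      w ++ [1] = applySub (sig d) v ++ (if v.getLast? = some (d - 1) then [1] else []) := by
  obtain ⟨hl, hr⟩ := h
  obtain ⟨h1, h2⟩ := hr.extensions hd
  obtain ⟨v, c, z, hL, hv, hz⟩ := Lang.desubst_right (r := [1, 1]) (by simpa using h1) hw0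
    (by simp) hw (by simp)
  obtain ⟨v', c', z', hL', hv', hz'⟩ := Lang.desubst_right (r := [1, 2]) (by simpa using h2) hw0
    (by simp) hw (by simp)
  have hov : IsOver d v := fun a ha => hL.isOver hd a (by simp [ha])
  have hov' : IsOver d v' := fun a ha => hL'.isOver hd a (by simp [ha])
  have hoz' : IsOver d z' := fun a ha => hL'.isOver hd a (by simp [ha])
  obtain rfl : v = v' := applySub_sig_injective hov hov' (hv.trans hv'.symm)
  have hc := hL.isOver hd c (by simp)
  have hc' := hL'.isOver hd c' (by simp)
  obtain rfl : c = d := by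
    obtain ⟨s, hs⟩ := hz
    have e1 := congrArg List.head? hs
    rw [head?_applySub_cons] at e1
    simp at e1
    have hc1 : c ≠ 1 := by
      rintro rfl
      simp [applySub, sig_one] at hs
    by_contra hcd
    have := e1 hc1 hcd
    omega
  obtain rfl : c' = 1 := by
    obtain ⟨s, hs⟩ := hz'
    have e1 := congrArg List.head? hs
    rw [head?_applySub_cons] at e1
    simp at e1
    have hcd : c' ≠ c := by
      rintro rfl
      rw [applySub, sig_top hd] at hs
      simp at hs
      exact head?_applySub_ne_two hoz' (by simp [← hs])
    by_contra hc1
    have := e1 hc1 hcd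
    omega
  have hv0 : v ≠ [] := by
    rintro rfl
    exact hw0 hv.symm
  obtain ⟨v₀, e, rfl⟩ : ∃ v₀ e, v = v₀ ++ [e] := by
    rcases List.eq_nil_or_concat v with h | ⟨v₀, e, rfl⟩
    · exact absurd h hv0
    · exact ⟨v₀, e, by simp⟩
  have he := Lang.step hd (s := v₀) (a := e) (b := c) (t := z) (by simpa using hL)
  refine ⟨v₀ ++ [e], hL.of_infix ⟨[], c :: z, by simp⟩, ⟨?_, ?_⟩, ?_⟩
  · exact LeftSpecial.desubst hd (r := [1]) hov hv0 (by rwa [hv]) (by simp) (by simpa [hv] using hl)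
  · exact ⟨c, 1, by omega, hc.1, hc.2, hc'.1, hc'.2, hL.of_infix ⟨[], z, by simp⟩,
      hL'.of_infix ⟨[], z', by simp⟩⟩
  · obtain rfl : e = c - 1 := by omega
    simp [hv]

/-- The image of a word ending in `k` extends by the `1` that follows when `k = d - 1`. -/
lemma Lang.applySub_append_ite {d k : ℕ} (hd : 3 ≤ d) {v : List ℕ} (h : Lang d (v ++ [k])) :
    Lang d (_root_.applySub (sig d) (v ++ [k]) ++ (if k = d - 1 then [1] else [])) := by
  split_ifs with hk
  · obtain ⟨c, hc⟩ := h.exists_append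
    have h1 := Lang.step hd (s := v) (a := k) (b := c) (t := []) (by simpa using hc)
    have h2 := hc.applySub
    rw [applySub_append, applySub_singleton] at h2
    rcases h1 with rfl | rfl
    · rw [sig_one] at h2
      exact h2.of_infix ⟨[], [2], by simp⟩
    · rw [show k + 1 = d by omega, sig_top hd] at h2
      exact h2
  · simpa using h.applySub

lemma LeftSpecial.applySub {d k : ℕ} (hd : 3 ≤ d) {v : List ℕ} (h : LeftSpecial d (v ++ [k])) :
    LeftSpecial d (applySub (sig d) (v ++ [k]) ++ (if k = d - 1 then [1] else [])) := by
  have key : ∀ a, Lang d (a :: (v ++ [k])) → 1 ≤ a ∧ a ≤ d →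
      Lang d ((if a = d then 1 else a + 1) ::
        (_root_.applySub (sig d) (v ++ [k]) ++ (if k = d - 1 then [1] else []))) := by
    intro a ha had
    have h1 := Lang.applySub_append_ite (v := a :: v) hd ha
    rw [List.cons_append, _root_.applySub] at h1
    obtain ⟨s, hs⟩ : ∃ s, sig d a = s ++ [if a = d then 1 else a + 1] := by
      by_cases ha1 : a = 1
      · subst ha1
        exact ⟨[1], by rw [sig_one, if_neg (by omega)]; rfl⟩
      · by_cases h2 : a = d
        · exact ⟨[], by rw [h2, sig_top hd, if_pos rfl]; rfl⟩
        · exact ⟨[], by simp [sig, ha1, h2]⟩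
    rw [hs] at h1
    exact h1.of_infix ⟨s, [], by simp⟩
  obtain ⟨a, b, hab, ha1, had, hb1, hbd, ha, hb⟩ := h
  refine ⟨_, _, ?_, ?_, ?_, ?_, ?_, key a ha ⟨ha1, had⟩, key b hb ⟨hb1, hbd⟩⟩ <;>
    split_ifs <;> omega

lemma RightSpecial.applySub {d k : ℕ} (hd : 3 ≤ d) {v : List ℕ} (h : RightSpecial d (v ++ [k])) :
    RightSpecial d (applySub (sig d) (v ++ [k]) ++ (if k = d - 1 then [1] else [])) := by
  obtain ⟨h1, h2⟩ := h.extensions hd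
  have hk := h1.isOver hd k (by simp)
  have hkd := h2.isOver hd (k + 1) (by simp)
  have s1 := h1.applySub
  rw [applySub_append, applySub_singleton, sig_one] at s1
  split_ifs with hkd1
  · obtain ⟨c, hc⟩ := h2.exists_append
    have hcd := hc.isOver hd c (by simp)
    have hc1 := Lang.step hd (s := v ++ [k]) (a := k + 1) (b := c) (t := []) (by simpa using hc)
    obtain rfl : c = 1 := by omega
    have s2 := hc.applySub
    rw [applySub_append, applySub_append, applySub_singleton, applySub_singleton, sig_one,
      show k + 1 = d by omega, sig_top hd] at s2
    exact ⟨1, 2, by omega, by omega, by omega, by omega, by omega,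
      s2.of_infix ⟨[], [2], by simp⟩, s1.of_infix ⟨[], [], by simp⟩⟩
  · have s2 := h2.applySub
    rw [applySub_append, applySub_singleton, sig_mid (by omega) (by omega)] at s2
    exact ⟨1, k + 1 + 1, by omega, by omega, by omega, by omega, by omega,
      s1.of_infix ⟨[], [2], by simp⟩, s2.of_infix ⟨[], [], by simp⟩⟩

/-- A word u ∈ L(Ω) with |u| > 1 is bispecial iff there is a bispecial v ∈ L(Ω) with
u = σ(v)·p, where p = 1 if the last letter of v is d−1 and p = ε otherwise. -/
theorem stmt_4 (d : ℕ) (hd : 3 ≤ d) (u : List ℕ) (hu : Lang d u) (hlen : 1 < u.length) :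
    Bispecial d u ↔ ∃ v : List ℕ, Lang d v ∧ Bispecial d v ∧
      u = applySub (sig d) v ++ (if v.getLast? = some (d - 1) then [1] else []) := by
  constructor
  · intro h
    obtain ⟨w, k, rfl⟩ : ∃ w k, u = w ++ [k] := by
      rcases List.eq_nil_or_concat u with rfl | ⟨w, k, rfl⟩
      · simp at hlen
      · exact ⟨w, k, by simp⟩
    obtain ⟨c, w, rfl⟩ : ∃ c w', w = c :: w' :=
      List.exists_cons_of_ne_nil (by rintro rfl; simp at hlen)
    obtain rfl : c = 1 := LeftSpecial.head_eq_one hd (w := w ++ [k]) h.1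
    have hk := hu.isOver hd k (by simp)
    rcases hk.1.eq_or_lt with rfl | hk2
    · exact h.desubst_of_one hd (by simp) (by simp)
    · exact h.desubst_of_two_le hd hk2 (by simp)
  · rintro ⟨v, -, hv, rfl⟩
    rcases List.eq_nil_or_concat v with rfl | ⟨v, k, rfl⟩
    · simp [applySub] at hlen
    · rw [List.concat_eq_append] at hv ⊢
      simp only [List.getLast?_concat, Option.some.injEq]
      exact ⟨hv.1.applySub hd, hv.2.applySub hd⟩
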